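/- T_{max,2}(17) = 81 and T_{max,3}(17) = 99; in particular, for l = 17 the function m1 ↦ T_{max,m1}(17) is strictly increasing on {1, 2, 3}. -/

import Mathlib

open MvPolynomial

/-- A monomial ideal: an ideal containing the monomials of all its elements. -/
def IsMonomialIdeal (I : Ideal (MvPolynomial (Fin 3) ℂ)) : Prop :=
  ∀ p ∈ I, ∀ d ∈ p.support, (monomial d (1 : ℂ)) ∈ I

/-- Borel-fixed (strongly stable) in characteristic 0: for every monomial in `I`
divisible by `x_j`, and every `i < j`, replacing one factor `x_j` by `x_i`
stays in `I`. -/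
def IsBorelFixed (I : Ideal (MvPolynomial (Fin 3) ℂ)) : Prop :=
  ∀ d : Fin 3 →₀ ℕ, (monomial d (1 : ℂ)) ∈ I →
    ∀ i j : Fin 3, i < j → 0 < d j →
      (monomial (d + Finsupp.single i 1 - Finsupp.single j 1) (1 : ℂ)) ∈ I

/-- The dimension of the tangent space to the Hilbert scheme at `[I]`,
namely `dim_ℂ Hom_R(I, R/I)`. -/
noncomputable def tangentDim (I : Ideal (MvPolynomial (Fin 3) ℂ)) : ℕ :=
  Module.finrank ℂ (↥I →ₗ[MvPolynomial (Fin 3) ℂ] (MvPolynomial (Fin 3) ℂ ⧸ I))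

/-- `TmaxEq l m1 T` says that `T` is the maximum of `dim_ℂ Hom_R(I, R/I)` over all
Borel-fixed monomial ideals `I ⊆ ℂ[x,y,z]` of colength `l` whose smallest pure power
of `x` lying in `I` is `x^{m1}`. -/
def TmaxEq (l m1 T : ℕ) : Prop :=
  IsGreatest { t : ℕ | ∃ I : Ideal (MvPolynomial (Fin 3) ℂ),
      IsMonomialIdeal I ∧ IsBorelFixed I ∧
      Module.finrank ℂ (MvPolynomial (Fin 3) ℂ ⧸ I) = l ∧
      (X 0 : MvPolynomial (Fin 3) ℂ) ^ m1 ∈ I ∧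
      (X 0 : MvPolynomial (Fin 3) ℂ) ^ (m1 - 1) ∉ I ∧
      t = tangentDim I } T

/-- The exponent vector with the given three entries. -/
noncomputable def expo (t : ℕ × ℕ × ℕ) : Fin 3 →₀ ℕ :=
  Finsupp.equivFunOnFinite.symm ![t.1, t.2.1, t.2.2]

/-- The monomial `x ^ t.1 * y ^ t.2.1 * z ^ t.2.2`. -/
noncomputable def mon (t : ℕ × ℕ × ℕ) : MvPolynomial (Fin 3) ℂ := monomial (expo t) 1

@[simp] lemma expo_zero (t : ℕ × ℕ × ℕ) : expo t 0 = t.1 := rfl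
@[simp] lemma expo_one (t : ℕ × ℕ × ℕ) : expo t 1 = t.2.1 := rfl
@[simp] lemma expo_two (t : ℕ × ℕ × ℕ) : expo t 2 = t.2.2 := rfl

lemma expo_coords (d : Fin 3 →₀ ℕ) : expo (d 0, d 1, d 2) = d := by
  ext i; fin_cases i <;> rfl

lemma expo_injective : Function.Injective expo := fun s t h => by
  have h0 := DFunLike.congr_fun h 0
  have h1 := DFunLike.congr_fun h 1
  have h2 := DFunLike.congr_fun h 2
  simp only [expo_zero, expo_one, expo_two] at h0 h1 h2
  exact Prod.ext h0 (Prod.ext h1 h2)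

lemma expo_add (s t : ℕ × ℕ × ℕ) : expo (s + t) = expo s + expo t := by
  ext i; fin_cases i <;> rfl

lemma expo_sub (s t : ℕ × ℕ × ℕ) : expo (s - t) = expo s - expo t := by
  ext i; fin_cases i <;> rfl

lemma expo_le {s t : ℕ × ℕ × ℕ} : expo s ≤ expo t ↔ s ≤ t := by
  rw [Finsupp.le_def, Fin.forall_fin_succ, Fin.forall_fin_two, Prod.le_def, Prod.le_def]
  rfl

lemma mon_mul (s t : ℕ × ℕ × ℕ) : mon s * mon t = mon (s + t) := by
  simp [mon, expo_add, monomial_mul]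

lemma X_zero_pow (n : ℕ) : (X 0 : MvPolynomial (Fin 3) ℂ) ^ n = mon (n, 0, 0) := by
  have : Finsupp.single 0 n = expo (n, 0, 0) := by ext i; fin_cases i <;> simp [expo]
  rw [X_pow_eq_monomial, mon, this]

section MonomialIdeal

variable {I : Ideal (MvPolynomial (Fin 3) ℂ)}

lemma mon_mem_of_le {s t : ℕ × ℕ × ℕ} (h : s ≤ t) (hs : mon s ∈ I) : mon t ∈ I := by
  rw [← tsub_add_cancel_of_le h, ← mon_mul]
  exact I.mul_mem_left _ hs

lemma coeff_eq_zero_of_mem (hI : IsMonomialIdeal I) {t : ℕ × ℕ × ℕ} (ht : mon t ∉ I)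
    {p : MvPolynomial (Fin 3) ℂ} (hp : p ∈ I) : coeff (expo t) p = 0 := by
  by_contra h
  exact ht (hI p hp _ (mem_support_iff.2 h))

lemma mem_of_coeff_eq_zero {p : MvPolynomial (Fin 3) ℂ}
    (h : ∀ t, mon t ∉ I → coeff (expo t) p = 0) : p ∈ I := by
  rw [← support_sum_monomial_coeff p]
  refine I.sum_mem fun d hd => ?_
  rw [← mul_one (coeff d p), ← C_mul_monomial]
  refine I.mul_mem_left _ ?_
  by_contra hd'
  rw [← expo_coords d] at hd' hd
  exact mem_support_iff.1 hd (h _ hd')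

open Classical in
/-- The coefficient of `mon t` as a functional on the quotient; meaningful for `mon t ∉ I`. -/
noncomputable def coeffQ (I : Ideal (MvPolynomial (Fin 3) ℂ)) (t : ℕ × ℕ × ℕ) :
    (MvPolynomial (Fin 3) ℂ ⧸ I) →ₗ[ℂ] ℂ :=
  if h : I.restrictScalars ℂ ≤ (lcoeff ℂ (expo t)).ker then
    (Submodule.liftQ (I.restrictScalars ℂ) (lcoeff ℂ (expo t)) h) ∘ₗ
      (Submodule.Quotient.restrictScalarsEquiv ℂ I).symm.toLinearMap
  else 0

lemma coeffQ_mk (hI : IsMonomialIdeal I) {t : ℕ × ℕ × ℕ} (ht : mon t ∉ I)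
    (p : MvPolynomial (Fin 3) ℂ) : coeffQ I t (Ideal.Quotient.mk I p) = coeff (expo t) p := by
  have h : I.restrictScalars ℂ ≤ (lcoeff ℂ (expo t)).ker := fun p hp =>
    coeff_eq_zero_of_mem hI ht hp
  rw [coeffQ, dif_pos h]
  rfl

lemma coeffQ_smul (hI : IsMonomialIdeal I) {t : ℕ × ℕ × ℕ} (ht : mon t ∉ I) (u : ℕ × ℕ × ℕ)
    (q : MvPolynomial (Fin 3) ℂ ⧸ I) :
    coeffQ I t (mon u • q) = if u ≤ t then coeffQ I (t - u) q else 0 := by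
  obtain ⟨p, rfl⟩ := Ideal.Quotient.mk_surjective q
  have : mon u • Ideal.Quotient.mk I p = Ideal.Quotient.mk I (mon u * p) := rfl
  rw [this, coeffQ_mk hI ht, mon, coeff_monomial_mul']
  simp only [expo_le, one_mul, ← expo_sub]
  split_ifs with h
  · rw [coeffQ_mk hI fun h' => ht (mon_mem_of_le tsub_le_self h')]
  · rfl

lemma eq_zero_of_coeffQ (hI : IsMonomialIdeal I) {q : MvPolynomial (Fin 3) ℂ ⧸ I}
    (h : ∀ t, mon t ∉ I → coeffQ I t q = 0) : q = 0 := by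
  obtain ⟨p, rfl⟩ := Ideal.Quotient.mk_surjective q
  refine Ideal.Quotient.eq_zero_iff_mem.2 (mem_of_coeff_eq_zero fun t ht => ?_)
  rw [← coeffQ_mk hI ht, h t ht]

lemma eq_of_coeffQ (hI : IsMonomialIdeal I) {q r : MvPolynomial (Fin 3) ℂ ⧸ I}
    (h : ∀ t, mon t ∉ I → coeffQ I t q = coeffQ I t r) : q = r :=
  sub_eq_zero.1 <| eq_zero_of_coeffQ hI fun t ht => by rw [map_sub, h t ht, sub_self]

open Classical in
/-- The coefficient of `mon a` in the image of `mon g`; meaningful for `mon g ∈ I`,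
`mon a ∉ I`. -/
noncomputable def homCoeff (I : Ideal (MvPolynomial (Fin 3) ℂ)) (g a : ℕ × ℕ × ℕ) :
    (↥I →ₗ[MvPolynomial (Fin 3) ℂ] (MvPolynomial (Fin 3) ℂ ⧸ I)) →ₗ[ℂ] ℂ :=
  if hg : mon g ∈ I then
    { toFun := fun φ => coeffQ I a (φ ⟨mon g, hg⟩)
      map_add' := fun φ ψ => by simp
      map_smul' := fun c φ => by simp }
  else 0

lemma homCoeff_apply {g : ℕ × ℕ × ℕ} (hg : mon g ∈ I) (a : ℕ × ℕ × ℕ)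
    (φ : ↥I →ₗ[MvPolynomial (Fin 3) ℂ] (MvPolynomial (Fin 3) ℂ ⧸ I)) :
    homCoeff I g a φ = coeffQ I a (φ ⟨mon g, hg⟩) := by
  rw [homCoeff, dif_pos hg]; rfl

lemma sub_add_eq_sub_add (g h : ℕ × ℕ × ℕ) : (h - g) + g = (g - h) + h := by
  ext <;> simp <;> omega

/-- The relation imposed by the syzygy of `mon g` and `mon h`. -/
lemma homCoeff_relation (hI : IsMonomialIdeal I) {g h a : ℕ × ℕ × ℕ} (hg : mon g ∈ I)
    (hh : mon h ∈ I) (ha : mon (a + (h - g)) ∉ I)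
    (φ : ↥I →ₗ[MvPolynomial (Fin 3) ℂ] (MvPolynomial (Fin 3) ℂ ⧸ I)) :
    homCoeff I g a φ =
      if g - h ≤ a + (h - g) then homCoeff I h (a + (h - g) - (g - h)) φ else 0 := by
  have key : mon (h - g) • φ ⟨mon g, hg⟩ = mon (g - h) • φ ⟨mon h, hh⟩ := by
    rw [← map_smul, ← map_smul]
    congr 1
    ext1
    simp only [Submodule.coe_smul, smul_eq_mul, mon_mul, sub_add_eq_sub_add]
  have := congrArg (coeffQ I (a + (h - g))) key
  rw [coeffQ_smul hI ha, coeffQ_smul hI ha, if_pos le_add_self, add_tsub_cancel_right] at this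
  rw [homCoeff_apply hg, homCoeff_apply hh, this]

/-- `G` consists of exponents of monomials generating `I`. -/
def Generates (G : List (ℕ × ℕ × ℕ)) (I : Ideal (MvPolynomial (Fin 3) ℂ)) : Prop :=
  (∀ g ∈ G, mon g ∈ I) ∧ ∀ t, mon t ∈ I → ∃ g ∈ G, g ≤ t

lemma mem_of_monomials (hI : IsMonomialIdeal I) {K : Ideal (MvPolynomial (Fin 3) ℂ)}
    (hK : ∀ t, mon t ∈ I → mon t ∈ K) {p : MvPolynomial (Fin 3) ℂ} (hp : p ∈ I) : p ∈ K :=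
  mem_of_coeff_eq_zero fun _ ht => coeff_eq_zero_of_mem hI (fun h => ht (hK _ h)) hp

lemma hom_eq_zero (hI : IsMonomialIdeal I) {G : List (ℕ × ℕ × ℕ)} (hG : Generates G I)
    {φ : ↥I →ₗ[MvPolynomial (Fin 3) ℂ] (MvPolynomial (Fin 3) ℂ ⧸ I)}
    (h : ∀ g ∈ G, ∀ a, mon a ∉ I → homCoeff I g a φ = 0) : φ = 0 := by
  have key : ∀ p ∈ I, p ∈ Submodule.map I.subtype (LinearMap.ker φ) := by
    refine fun p hp => mem_of_monomials (K := Submodule.map I.subtype (LinearMap.ker φ)) hI ?_ hp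
    intro t ht
    obtain ⟨g, hg, hgt⟩ := hG.2 t ht
    rw [← tsub_add_cancel_of_le hgt, ← mon_mul]
    refine Ideal.mul_mem_left _ _ ⟨⟨mon g, hG.1 g hg⟩, ?_, rfl⟩
    refine eq_zero_of_coeffQ hI fun a ha => ?_
    rw [← homCoeff_apply, h g hg a ha]
  ext1 p
  obtain ⟨q, hq, hqp⟩ := key p p.2
  obtain rfl : q = p := Subtype.ext hqp
  exact hq

/-- Componentwise comparison, with a kernel-friendly implementation. -/
def leB (s t : ℕ × ℕ × ℕ) : Bool :=
  Nat.ble s.1 t.1 && Nat.ble s.2.1 t.2.1 && Nat.ble s.2.2 t.2.2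

/-- `a + (h - g)`, with truncated subtraction. -/
def shift (g h a : ℕ × ℕ × ℕ) : ℕ × ℕ × ℕ :=
  (a.1 + (h.1 - g.1), a.2.1 + (h.2.1 - g.2.1), a.2.2 + (h.2.2 - g.2.2))

/-- `a + (h - g) - (g - h)`, with truncated subtraction. -/
def target (g h a : ℕ × ℕ × ℕ) : ℕ × ℕ × ℕ :=
  (a.1 + (h.1 - g.1) - (g.1 - h.1), a.2.1 + (h.2.1 - g.2.1) - (g.2.1 - h.2.1),
    a.2.2 + (h.2.2 - g.2.2) - (g.2.2 - h.2.2))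

/-- The condition `g - h ≤ a + (h - g)`, under which `target g h a` is a genuine exponent. -/
def fits (g h a : ℕ × ℕ × ℕ) : Bool :=
  Nat.ble (g.1 - h.1) (a.1 + (h.1 - g.1)) && Nat.ble (g.2.1 - h.2.1) (a.2.1 + (h.2.1 - g.2.1)) &&
    Nat.ble (g.2.2 - h.2.2) (a.2.2 + (h.2.2 - g.2.2))

/-- The order ideal of exponents below the heights `f`. -/
def below (f : ℕ → ℕ → ℕ) (t : ℕ × ℕ × ℕ) : Bool := Nat.blt t.2.2 (f t.1 t.2.1)

/-- Some syzygy forces the `(g, a)` coefficient to vanish. -/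
def forcedZero (f : ℕ → ℕ → ℕ) (G : List (ℕ × ℕ × ℕ)) (g a : ℕ × ℕ × ℕ) : Bool :=
  G.any fun h => below f (shift g h a) && !fits g h a

/-- Some syzygy with an element of `pre` expresses the `(g, a)` coefficient. -/
def reducesTo (f : ℕ → ℕ → ℕ) (pre : List (ℕ × ℕ × ℕ)) (g a : ℕ × ℕ × ℕ) : Bool :=
  pre.any fun h => below f (shift g h a)

/-- The pairs `(g, a)`, `g ∈ rest`, not reducible to generators preceding `g`. -/
def irreducibles (f : ℕ → ℕ → ℕ) (A G : List (ℕ × ℕ × ℕ)) :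
    List (ℕ × ℕ × ℕ) → List (ℕ × ℕ × ℕ) → List ((ℕ × ℕ × ℕ) × (ℕ × ℕ × ℕ))
  | _, [] => []
  | pre, g :: rest =>
    (A.filter fun a => !(reducesTo f pre g a || forcedZero f G g a)).map (fun a => (g, a)) ++
      irreducibles f A G (g :: pre) rest

/-- The monomial ideal `I` has standard monomials exactly those below the heights `f`. -/
def HasHeights (I : Ideal (MvPolynomial (Fin 3) ℂ)) (f : ℕ → ℕ → ℕ) : Prop :=
  ∀ t, mon t ∉ I ↔ below f t

lemma fits_iff {g h a : ℕ × ℕ × ℕ} : fits g h a ↔ g - h ≤ a + (h - g) := by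
  simp [fits, Prod.le_def, and_assoc]

variable {f : ℕ → ℕ → ℕ} {A G : List (ℕ × ℕ × ℕ)}

lemma homCoeff_eq (hI : IsMonomialIdeal I) (hf : HasHeights I f) {g h a : ℕ × ℕ × ℕ}
    (hg : mon g ∈ I) (hh : mon h ∈ I) (ha : below f (shift g h a))
    (φ : ↥I →ₗ[MvPolynomial (Fin 3) ℂ] (MvPolynomial (Fin 3) ℂ ⧸ I)) :
    homCoeff I g a φ = if fits g h a then homCoeff I h (target g h a) φ else 0 := by
  rw [homCoeff_relation hI hg hh ((hf _).2 ha)]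
  simp only [fits_iff]
  rfl

lemma target_notMem (hf : HasHeights I f) {g h a : ℕ × ℕ × ℕ}
    (ha : below f (shift g h a)) : mon (target g h a) ∉ I := fun h' =>
  (hf _).2 ha (mon_mem_of_le (s := target g h a) (t := shift g h a)
    ⟨Nat.sub_le _ _, Nat.sub_le _ _, Nat.sub_le _ _⟩ h')

lemma homCoeff_eq_zero_of_irreducibles (hI : IsMonomialIdeal I) (hf : HasHeights I f)
    (hA : ∀ t, below f t → t ∈ A) (hG : ∀ g ∈ G, mon g ∈ I)
    {φ : ↥I →ₗ[MvPolynomial (Fin 3) ℂ] (MvPolynomial (Fin 3) ℂ ⧸ I)}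
    (rest pre : List (ℕ × ℕ × ℕ)) (hrest : ∀ g ∈ rest, g ∈ G) (hpre : ∀ g ∈ pre, g ∈ G)
    (h0 : ∀ g ∈ pre, ∀ a, mon a ∉ I → homCoeff I g a φ = 0)
    (h : ∀ s ∈ irreducibles f A G pre rest, homCoeff I s.1 s.2 φ = 0) :
    ∀ g ∈ rest, ∀ a, mon a ∉ I → homCoeff I g a φ = 0 := by
  induction rest generalizing pre with
  | nil => simp
  | cons g rest ih =>
    simp only [List.mem_cons, forall_eq_or_imp] at hrest
    have hg : ∀ a, mon a ∉ I → homCoeff I g a φ = 0 := by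
      intro a ha
      by_cases hr : reducesTo f pre g a
      · obtain ⟨k, hk, hb⟩ := List.any_eq_true.1 hr
        rw [homCoeff_eq hI hf (hG g hrest.1) (hG k (hpre k hk)) hb,
          h0 k hk _ (target_notMem hf hb), ite_self]
      by_cases hz : forcedZero f G g a
      · obtain ⟨k, hk, hb⟩ := List.any_eq_true.1 hz
        rw [Bool.and_eq_true, Bool.not_eq_true'] at hb
        rw [homCoeff_eq hI hf (hG g hrest.1) (hG k hk) hb.1, hb.2]
        rfl
      · refine h (g, a) (List.mem_append_left _ (List.mem_map_of_mem ?_))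
        rw [List.mem_filter]
        exact ⟨hA a ((hf a).1 ha), by simp [hr, hz]⟩
    have := ih (g :: pre) hrest.2 (List.forall_mem_cons.2 ⟨hrest.1, hpre⟩)
      (List.forall_mem_cons.2 ⟨hg, h0⟩)
      fun s hs => h s (List.mem_append_right _ hs)
    exact List.forall_mem_cons.2 ⟨hg, this⟩

/-- The coefficients at the irreducible pairs. -/
noncomputable def evalAt (I : Ideal (MvPolynomial (Fin 3) ℂ))
    (S : List ((ℕ × ℕ × ℕ) × (ℕ × ℕ × ℕ))) :
    (↥I →ₗ[MvPolynomial (Fin 3) ℂ] (MvPolynomial (Fin 3) ℂ ⧸ I)) →ₗ[ℂ] (Fin S.length → ℂ) :=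
  LinearMap.pi fun k => homCoeff I (S.get k).1 (S.get k).2

lemma evalAt_injective (hI : IsMonomialIdeal I) (hf : HasHeights I f)
    (hA : ∀ t, below f t → t ∈ A) (hG : Generates G I) :
    Function.Injective (evalAt I (irreducibles f A G [] G)) := by
  rw [injective_iff_map_eq_zero]
  intro φ hφ
  refine hom_eq_zero hI hG (homCoeff_eq_zero_of_irreducibles hI hf hA hG.1 G []
    (fun _ => id) (by simp) (by simp) fun s hs => ?_)
  obtain ⟨k, rfl⟩ := List.get_of_mem hs
  exact congrFun hφ k

/-- An upper bound for the dimension of the tangent space. -/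
theorem tangentDim_le (hI : IsMonomialIdeal I) (hf : HasHeights I f)
    (hA : ∀ t, below f t → t ∈ A) (hG : Generates G I) :
    tangentDim I ≤ (irreducibles f A G [] G).length := by
  simpa [tangentDim] using LinearMap.finrank_le_finrank_of_injective (evalAt_injective hI hf hA hG)

/-- Compatible values on generators extend to a homomorphism. -/
theorem exists_hom (hI : IsMonomialIdeal I) (hG : Generates G I)
    (w : ℕ × ℕ × ℕ → MvPolynomial (Fin 3) ℂ ⧸ I)
    (hw : ∀ g ∈ G, ∀ h ∈ G, mon (h - g) • w g = mon (g - h) • w h) :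
    ∃ φ : ↥I →ₗ[MvPolynomial (Fin 3) ℂ] (MvPolynomial (Fin 3) ℂ ⧸ I),
      ∀ g ∈ G, ∀ hg : mon g ∈ I, φ ⟨mon g, hg⟩ = w g := by
  classical
  have hw' : ∀ t, ∀ g ∈ G, g ≤ t → ∀ h ∈ G, h ≤ t → mon (t - g) • w g = mon (t - h) • w h := by
    intro t g hg hgt h hh hht
    have h1 : t - g = (t - g - (h - g)) + (h - g) := by
      rw [Prod.le_def, Prod.le_def] at hgt hht
      ext <;> simp at * <;> omega
    have h2 : t - h = (t - g - (h - g)) + (g - h) := by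
      rw [Prod.le_def, Prod.le_def] at hgt hht
      ext <;> simp at * <;> omega
    rw [h1, h2, ← mon_mul, ← mon_mul, mul_smul, mul_smul, hw g hg h hh]
  choose! γ hγ hγt using hG.2
  let F : (Fin 3 →₀ ℕ) → MvPolynomial (Fin 3) ℂ ⧸ I := fun d =>
    if mon (d 0, d 1, d 2) ∈ I then
      mon ((d 0, d 1, d 2) - γ (d 0, d 1, d 2)) • w (γ (d 0, d 1, d 2)) else 0
  let ψ : MvPolynomial (Fin 3) ℂ →ₗ[ℂ] MvPolynomial (Fin 3) ℂ ⧸ I :=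
    (basisMonomials (Fin 3) ℂ).constr ℂ F
  have hψ : ∀ t, mon t ∈ I → ∀ g ∈ G, g ≤ t → ψ (mon t) = mon (t - g) • w g := by
    intro t ht g hg hgt
    have : ψ (mon t) = F (expo t) := (basisMonomials (Fin 3) ℂ).constr_basis ℂ F (expo t)
    rw [this]
    change (if mon t ∈ I then mon (t - γ t) • w (γ t) else 0) = _
    rw [if_pos ht, hw' t _ (hγ t ht) (hγt t ht) g hg hgt]
  let K : Ideal (MvPolynomial (Fin 3) ℂ) :=
    { carrier := {p | ∀ r, ψ (r * p) = r • ψ p}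
      add_mem' := fun {p q} hp hq r => by rw [mul_add, map_add, map_add, hp, hq, smul_add]
      zero_mem' := fun r => by simp
      smul_mem' := fun s p hp r => by
        rw [smul_eq_mul, ← mul_assoc, hp, hp, mul_smul] }
  have hK : ∀ t, mon t ∈ I → mon t ∈ K := by
    intro t ht
    have : ψ ∘ₗ LinearMap.mulRight ℂ (mon t) =
        (LinearMap.toSpanSingleton (MvPolynomial (Fin 3) ℂ) _ (ψ (mon t))).restrictScalars ℂ := by
      refine (basisMonomials (Fin 3) ℂ).ext fun d => ?_
      rw [coe_basisMonomials, ← expo_coords d]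
      change ψ (mon _ * mon t) = mon _ • ψ (mon t)
      have hst := I.mul_mem_left (mon (d 0, d 1, d 2)) ht
      rw [mon_mul] at hst ⊢
      rw [hψ t ht _ (hγ t ht) (hγt t ht),
        hψ _ hst _ (hγ t ht) ((hγt t ht).trans le_add_self), ← mul_smul, mon_mul,
        add_tsub_assoc_of_le (hγt t ht)]
    exact fun r => LinearMap.congr_fun this r
  refine ⟨{ toFun := fun p => ψ p
            map_add' := fun p q => map_add ψ _ _
            map_smul' := fun r p => mem_of_monomials hI hK p.2 r }, fun g hg hgI => ?_⟩
  change ψ (mon g) = w g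
  rw [hψ g hgI g hg le_rfl, tsub_self]
  have : mon 0 = 1 := by
    have := X_zero_pow 0
    rw [pow_zero] at this
    exact this.symm
  rw [this, one_smul]

/-- The irreducible pair to which `(g, a)` reduces, if any; the list holds the generators up to
`g`, in reverse order. -/
def label (f : ℕ → ℕ → ℕ) (G : List (ℕ × ℕ × ℕ)) :
    List (ℕ × ℕ × ℕ) → ℕ × ℕ × ℕ → ℕ × ℕ × ℕ → Option ((ℕ × ℕ × ℕ) × (ℕ × ℕ × ℕ))
  | [], _, _ => none
  | k :: pre, g, a =>
    bif leB g k && leB k g then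
      bif forcedZero f G g a then none
      else
        match pre.find? fun h => below f (shift g h a) with
        | none => some (g, a)
        | some h => label f G pre h (target g h a)
    else label f G pre g a

/-- The labelling respects all syzygies. -/
def Consistent (f : ℕ → ℕ → ℕ) (A G : List (ℕ × ℕ × ℕ)) : Prop :=
  ∀ g ∈ G, ∀ h ∈ G, ∀ a ∈ A, below f (shift g h a) →
    label f G G.reverse g a =
      if fits g h a then label f G G.reverse h (target g h a) else none

lemma shift_sub {g h b : ℕ × ℕ × ℕ} (hb : h - g ≤ b) : shift g h (b - (h - g)) = b :=
  tsub_add_cancel_of_le hb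

lemma target_sub {g h b : ℕ × ℕ × ℕ} (hb : h - g ≤ b) :
    target g h (b - (h - g)) = b - (g - h) :=
  congrArg (· - (g - h)) (shift_sub hb)

lemma fits_sub {g h b : ℕ × ℕ × ℕ} (hb : h - g ≤ b) :
    fits g h (b - (h - g)) ↔ g - h ≤ b := by
  rw [fits_iff, tsub_add_cancel_of_le hb]

lemma exists_hom_of_label (hI : IsMonomialIdeal I) (hf : HasHeights I f)
    (hA : ∀ t, below f t ↔ t ∈ A) (hG : Generates G I) (hc : Consistent f A G)
    (s : (ℕ × ℕ × ℕ) × (ℕ × ℕ × ℕ)) :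
    ∃ φ : ↥I →ₗ[MvPolynomial (Fin 3) ℂ] (MvPolynomial (Fin 3) ℂ ⧸ I),
      ∀ g ∈ G, ∀ a, mon a ∉ I →
        homCoeff I g a φ = if label f G G.reverse g a = some s then 1 else 0 := by
  classical
  let w : ℕ × ℕ × ℕ → MvPolynomial (Fin 3) ℂ ⧸ I := fun g =>
    Ideal.Quotient.mk I (∑ a ∈ A.toFinset with label f G G.reverse g a = some s, mon a)
  have hw : ∀ g a, mon a ∉ I →
      coeffQ I a (w g) = if label f G G.reverse g a = some s then 1 else 0 := by
    intro g a ha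
    have haA : a ∈ A := (hA a).1 ((hf a).1 ha)
    simp only [w]
    rw [coeffQ_mk hI ha, coeff_sum]
    simp only [mon, coeff_monomial, expo_injective.eq_iff]
    simp [haA]
  have hrel : ∀ g ∈ G, ∀ h ∈ G, ∀ b, mon b ∉ I → h - g ≤ b →
      coeffQ I b (mon (h - g) • w g) = coeffQ I b (mon (g - h) • w h) := by
    intro g hg h hh b hb hle
    rw [coeffQ_smul hI hb, coeffQ_smul hI hb, if_pos hle,
      hw _ _ fun h' => hb (mon_mem_of_le tsub_le_self h')]
    have hlow : below f (shift g h (b - (h - g))) := by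
      rw [shift_sub hle]; exact (hf b).1 hb
    have hmem : b - (h - g) ∈ A :=
      (hA _).1 ((hf _).1 fun h' => hb (mon_mem_of_le tsub_le_self h'))
    rw [hc g hg h hh _ hmem hlow, target_sub hle]
    simp only [fits_sub hle]
    split_ifs with h1 h2 h2
    · rw [hw _ _ fun h' => hb (mon_mem_of_le tsub_le_self h'), if_pos h2]
    · rw [hw _ _ fun h' => hb (mon_mem_of_le tsub_le_self h'), if_neg h2]
    · simp_all
    · rfl
  obtain ⟨φ, hφ⟩ := exists_hom hI hG w fun g hg h hh => eq_of_coeffQ hI fun b hb => by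
    by_cases h1 : h - g ≤ b
    · exact hrel g hg h hh b hb h1
    by_cases h2 : g - h ≤ b
    · exact (hrel h hh g hg b hb h2).symm
    · rw [coeffQ_smul hI hb, coeffQ_smul hI hb, if_neg h1, if_neg h2]
  refine ⟨φ, fun g hg a ha => ?_⟩
  rw [homCoeff_apply (hG.1 g hg), hφ g hg, hw g a ha]

/-- The dimension of the tangent space, from a consistent labelling. -/
theorem tangentDim_eq (hI : IsMonomialIdeal I) (hf : HasHeights I f)
    (hA : ∀ t, below f t ↔ t ∈ A) (hG : Generates G I) (hc : Consistent f A G)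
    (hS : ∀ s ∈ irreducibles f A G [] G, s.1 ∈ G ∧ below f s.2 ∧
      label f G G.reverse s.1 s.2 = some s)
    (hnd : (irreducibles f A G [] G).Nodup) :
    tangentDim I = (irreducibles f A G [] G).length := by
  set S := irreducibles f A G [] G with hSdef
  have hinj : Function.Injective (evalAt I S) := evalAt_injective hI hf (fun t => (hA t).1) hG
  have hsurj : Function.Surjective (evalAt I S) := by
    rw [← LinearMap.range_eq_top, ← top_le_iff, ← (Pi.basisFun ℂ (Fin S.length)).span_eq,
      Submodule.span_le]
    rintro _ ⟨k, rfl⟩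
    obtain ⟨φ, hφ⟩ := exists_hom_of_label hI hf hA hG hc (S.get k)
    refine ⟨φ, funext fun j => ?_⟩
    obtain ⟨h1, h2, h3⟩ := hS (S.get j) (S.get_mem j)
    change homCoeff I _ _ φ = _
    rw [hφ _ h1 _ ((hf _).2 h2), h3]
    simp [Pi.single_apply, hnd.getElem_inj_iff, Fin.ext_iff]
  simpa [tangentDim] using (LinearEquiv.ofBijective _ ⟨hinj, hsurj⟩).finrank_eq

/-- The residue classes of the standard monomials form a basis of the quotient. -/
lemma finrank_quotient (hI : IsMonomialIdeal I) :
    Module.finrank ℂ (MvPolynomial (Fin 3) ℂ ⧸ I) = {t | mon t ∉ I}.ncard := by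
  classical
  let v : {t | mon t ∉ I} → MvPolynomial (Fin 3) ℂ ⧸ I := fun t => Ideal.Quotient.mk I (mon t)
  have hv : ∀ s t : {t | mon t ∉ I}, coeffQ I s (v t) = if t = s then 1 else 0 := by
    intro s t
    simp only [v]
    rw [coeffQ_mk hI s.2, mon, coeff_monomial]
    simp [expo_injective.eq_iff, Subtype.ext_iff]
  have hli : LinearIndependent ℂ v := by
    rw [linearIndependent_iff']
    intro s c hc i hi
    have := congrArg (coeffQ I i) hc
    simpa [map_sum, hv, hi] using this
  have hsp : ⊤ ≤ Submodule.span ℂ (Set.range v) := by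
    rintro q -
    obtain ⟨p, rfl⟩ := Ideal.Quotient.mk_surjective q
    rw [← support_sum_monomial_coeff p, map_sum]
    refine Submodule.sum_mem _ fun d _ => ?_
    have hd : Ideal.Quotient.mk I (monomial d (coeff d p)) =
        coeff d p • Ideal.Quotient.mk I (mon (d 0, d 1, d 2)) := by
      rw [mon, expo_coords, ← mul_one (coeff d p), ← smul_eq_mul, ← smul_monomial]
      simp only [smul_eq_mul, mul_one]
      rfl
    rw [hd]
    refine Submodule.smul_mem _ _ ?_
    by_cases h : mon (d 0, d 1, d 2) ∈ I
    · rw [Ideal.Quotient.eq_zero_iff_mem.2 h]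
      exact Submodule.zero_mem _
    · exact Submodule.subset_span ⟨⟨_, h⟩, rfl⟩
  rw [Module.finrank_eq_nat_card_basis (Module.Basis.mk hli hsp), Nat.card_coe_set_eq]

lemma exists_heights (hI : IsMonomialIdeal I)
    (hfin : Module.finrank ℂ (MvPolynomial (Fin 3) ℂ ⧸ I) ≠ 0) : ∃ f, HasHeights I f := by
  classical
  rw [finrank_quotient hI] at hfin
  have hfinite := Set.finite_of_ncard_ne_zero hfin
  have hex : ∀ i j, ∃ k, mon (i, j, k) ∈ I := by
    intro i j
    by_contra! h
    refine Set.infinite_of_injective_forall_mem (f := fun k : ℕ => (i, j, k)) ?_ h hfinite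
    intro a b hab
    simpa using hab
  refine ⟨fun i j => Nat.find (hex i j), fun ⟨i, j, k⟩ => ?_⟩
  simp only [below, Nat.blt_eq, Nat.lt_find_iff]
  refine ⟨fun h m hm hmem => h ?_, fun h => h k le_rfl⟩
  exact mon_mem_of_le (s := (i, j, m)) (t := (i, j, k)) ⟨le_rfl, le_rfl, hm⟩ hmem

lemma HasHeights.mem_iff (hf : HasHeights I f) (i j k : ℕ) :
    mon (i, j, k) ∈ I ↔ f i j ≤ k := by
  rw [← not_iff_not, hf]
  simp [below]

/-- The conditions on the heights of a Borel-fixed ideal. -/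
structure BorelHeights (f : ℕ → ℕ → ℕ) : Prop where
  succ_right : ∀ i j, f i (j + 1) ≤ f i j - 1
  succ_left : ∀ i j, f (i + 1) j ≤ f i (j + 1)

lemma BorelHeights.of_isBorelFixed (hB : IsBorelFixed I) (hf : HasHeights I f) :
    BorelHeights f where
  succ_right i j := by
    have h := hB (expo (i, j, f i j - 1 + 1)) ((hf.mem_iff _ _ _).2 (by omega)) 1 2
      (by decide) (by simp)
    have e : expo (i, j + 1, f i j - 1) = expo (i, j, f i j - 1 + 1) + Finsupp.single 1 1 -
        Finsupp.single 2 1 := by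
      ext n; fin_cases n <;> simp
    rw [← hf.mem_iff, mon, e]
    exact h
  succ_left i j := by
    have h := hB (expo (i, j + 1, f i (j + 1))) ((hf.mem_iff _ _ _).2 le_rfl) 0 1
      (by decide) (by simp)
    have e : expo (i + 1, j, f i (j + 1)) = expo (i, j + 1, f i (j + 1)) + Finsupp.single 0 1 -
        Finsupp.single 1 1 := by
      ext n; fin_cases n <;> simp
    rw [← hf.mem_iff, mon, e]
    exact h

lemma sum_heights_le (hI : IsMonomialIdeal I) (hf : HasHeights I f)
    (hfin : Module.finrank ℂ (MvPolynomial (Fin 3) ℂ ⧸ I) ≠ 0) (J : Finset (ℕ × ℕ)) :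
    ∑ p ∈ J, f p.1 p.2 ≤ Module.finrank ℂ (MvPolynomial (Fin 3) ℂ ⧸ I) ∧
      ((∀ i j, f i j ≠ 0 → (i, j) ∈ J) →
        ∑ p ∈ J, f p.1 p.2 = Module.finrank ℂ (MvPolynomial (Fin 3) ℂ ⧸ I)) := by
  classical
  rw [finrank_quotient hI] at hfin ⊢
  let B : Finset (ℕ × ℕ × ℕ) := (J.sigma fun p => Finset.range (f p.1 p.2)).image
    fun x => (x.1.1, x.1.2, x.2)
  have hcard : B.card = ∑ p ∈ J, f p.1 p.2 := by
    rw [Finset.card_image_of_injective, Finset.card_sigma]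
    · simp
    · rintro ⟨⟨i, j⟩, k⟩ ⟨⟨i', j'⟩, k'⟩ h
      simp only [Prod.mk.injEq] at h
      obtain ⟨rfl, rfl, rfl⟩ := h
      rfl
  have hB : ∀ t, t ∈ B ↔ (t.1, t.2.1) ∈ J ∧ mon t ∉ I := by
    rintro ⟨i, j, k⟩
    rw [hf]
    simp [B, below, and_assoc]
  rw [← hcard, ← Set.ncard_coe_finset]
  refine ⟨Set.ncard_le_ncard (fun t ht => ((hB t).1 ht).2) (Set.finite_of_ncard_ne_zero hfin),
    fun h => congrArg _ (Set.ext fun t => ?_)⟩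
  rw [Finset.mem_coe, hB]
  refine ⟨fun ht => ht.2, fun ht => ⟨h _ _ fun h0 => ?_, ht⟩⟩
  have := (hf t).1 ht
  simp [below, h0] at this

/-- `f` vanishes outside the columns `i < 3`, `j < 5`. -/
def Bounded (f : ℕ → ℕ → ℕ) : Prop := ∀ i j, 3 ≤ i ∨ 5 ≤ j → f i j = 0

lemma bounded_of_borelHeights (hb : BorelHeights f) (h3 : f 3 0 = 0)
    (hsum : ∑ j ∈ Finset.range 6, f 0 j ≤ 17) :
    Bounded f ∧ ∀ i j, 5 ≤ i + j → f i j = 0 := by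
  have h5 : f 0 5 = 0 := by
    have h0 : f 0 1 ≤ f 0 0 - 1 := hb.succ_right 0 0
    have h1 : f 0 2 ≤ f 0 1 - 1 := hb.succ_right 0 1
    have h2 : f 0 3 ≤ f 0 2 - 1 := hb.succ_right 0 2
    have h3 : f 0 4 ≤ f 0 3 - 1 := hb.succ_right 0 3
    have h4 : f 0 5 ≤ f 0 4 - 1 := hb.succ_right 0 4
    simp only [Finset.sum_range_succ, Finset.sum_range_zero] at hsum
    omega
  have hmono : ∀ i j, f i (j + 1) ≤ f i j := fun i j => (hb.succ_right i j).trans (Nat.sub_le _ _)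
  have hanti : ∀ i, Antitone (f i) := fun i => antitone_nat_of_succ_le (hmono i)
  have hdiag : ∀ i j, f i j ≤ f 0 (i + j) := by
    intro i
    induction i with
    | zero => intro j; rw [zero_add]
    | succ i ih =>
      intro j
      refine (hb.succ_left i j).trans ((ih (j + 1)).trans (le_of_eq ?_))
      congr 1
      omega
  have hdiag0 : ∀ i j, 5 ≤ i + j → f i j = 0 := fun i j h =>
    Nat.le_zero.1 ((hdiag i j).trans ((hanti 0 h).trans h5.le))
  have hrow : ∀ i, 3 ≤ i → f i 0 = 0 := by
    intro i hi
    induction i, hi using Nat.le_induction with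
    | base => exact h3
    | succ i _ ih => exact Nat.le_zero.1 ((hb.succ_left i 0).trans ((hmono i 0).trans ih.le))
  refine ⟨fun i j h => ?_, hdiag0⟩
  rcases h with h | h
  · exact Nat.le_zero.1 ((hanti i (Nat.zero_le j)).trans (hrow i h).le)
  · exact hdiag0 i j (by omega)

/-- The `n`-th entry of a list, or the default value; defined by structural recursion, so that it
evaluates quickly in the kernel. -/
noncomputable def nth {α : Type} (d : α) (l : List α) : ℕ → α :=
  List.rec (fun _ => d) (fun x _ ih n => Nat.rec x (fun m _ => ih m) n) l

/-- The height function with the given rows. -/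
noncomputable def heights (L : List (List ℕ)) (i j : ℕ) : ℕ := nth 0 (nth [] L i) j

/-- The exponents below `f` in the columns `i < 3`, `j < 5`. -/
def cells (f : ℕ → ℕ → ℕ) : List (ℕ × ℕ × ℕ) :=
  [0, 1, 2].flatMap fun i => [0, 1, 2, 3, 4].flatMap fun j =>
    (List.range (f i j)).map fun k => (i, j, k)

/-- Neither of the neighbouring columns `(i - 1, j)` and `(i, j - 1)` is as low as `(i, j)`. -/
def isCorner (f : ℕ → ℕ → ℕ) (i j : ℕ) : Bool :=
  (Nat.beq i 0 || Nat.blt (f i j) (f (i - 1) j)) && (Nat.beq j 0 || Nat.blt (f i j) (f i (j - 1)))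

/-- The minimal exponents not below `f` in the columns `i < 4`, `j < 6`. -/
def corners (f : ℕ → ℕ → ℕ) : List (ℕ × ℕ × ℕ) :=
  [0, 1, 2, 3].flatMap fun i =>
    ([0, 1, 2, 3, 4, 5].filter fun j => isCorner f i j).map fun j => (i, j, f i j)

lemma mem_cells (hf : Bounded f) (t : ℕ × ℕ × ℕ) : below f t ↔ t ∈ cells f := by
  obtain ⟨i, j, k⟩ := t
  have hi : i ∈ [0, 1, 2] ↔ i < 3 := by simp; omega
  have hj : j ∈ [0, 1, 2, 3, 4] ↔ j < 5 := by simp; omega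
  have h : (i, j, k) ∈ cells f ↔ i ∈ [0, 1, 2] ∧ j ∈ [0, 1, 2, 3, 4] ∧ k < f i j := by
    unfold cells
    generalize [0, 1, 2] = l
    generalize [0, 1, 2, 3, 4] = l'
    simp [List.mem_flatMap]
  rw [h, hi, hj, below, Nat.blt_eq]
  refine ⟨fun hk => ?_, fun hk => hk.2.2⟩
  have := mt (hf i j) (by simp only at hk; omega)
  exact ⟨by omega, by omega, hk⟩

lemma mem_corners {i j : ℕ} (hi : i ≤ 3) (hj : j ≤ 5) (h : isCorner f i j) :
    (i, j, f i j) ∈ corners f := by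
  have hi' : i ∈ [0, 1, 2, 3] := by simp; omega
  have hj' : j ∈ [0, 1, 2, 3, 4, 5] := by simp; omega
  exact List.mem_flatMap.2 ⟨i, hi', List.mem_map.2 ⟨j, List.mem_filter.2 ⟨hj', h⟩, rfl⟩⟩

lemma exists_corner_le {k : ℕ} : ∀ n i j : ℕ, i + j = n → i ≤ 3 → j ≤ 5 → f i j ≤ k →
    ∃ c ∈ corners f, c ≤ (i, j, k) := by
  intro n
  induction n with
  | zero =>
    intro i j hn hi hj hk
    obtain ⟨rfl, rfl⟩ : i = 0 ∧ j = 0 := by omega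
    exact ⟨_, mem_corners hi hj rfl, le_rfl, le_rfl, hk⟩
  | succ n ih =>
    intro i j hn hi hj hk
    by_cases h : isCorner f i j
    · exact ⟨_, mem_corners hi hj h, le_rfl, le_rfl, hk⟩
    · have : (i ≠ 0 ∧ f (i - 1) j ≤ f i j) ∨ (j ≠ 0 ∧ f i (j - 1) ≤ f i j) := by
        simp [isCorner] at h
        omega
      rcases this with ⟨h0, h⟩ | ⟨h0, h⟩
      · obtain ⟨c, hc, hle⟩ := ih (i - 1) j (by omega) (by omega) hj (h.trans hk)
        exact ⟨c, hc, hle.trans ⟨Nat.sub_le _ _, le_rfl, le_rfl⟩⟩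
      · obtain ⟨c, hc, hle⟩ := ih i (j - 1) (by omega) hi (by omega) (h.trans hk)
        exact ⟨c, hc, hle.trans ⟨le_rfl, Nat.sub_le _ _, le_rfl⟩⟩

lemma generates_corners (hf : HasHeights I f) (hbd : Bounded f) : Generates (corners f) I := by
  refine ⟨fun g hg => ?_, fun ⟨i, j, k⟩ ht => ?_⟩
  · simp only [corners, List.mem_flatMap, List.mem_map] at hg
    obtain ⟨i, -, j, -, rfl⟩ := hg
    exact (hf.mem_iff _ _ _).2 le_rfl
  · rw [hf.mem_iff] at ht
    have hk : f (min i 3) (min j 5) ≤ k := by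
      by_cases h : i ≤ 3 ∧ j ≤ 5
      · rwa [min_eq_left h.1, min_eq_left h.2]
      · rw [hbd _ _ (by omega)]
        exact Nat.zero_le k
    obtain ⟨c, hc, hle⟩ := exists_corner_le _ _ _ rfl (min_le_right _ _) (min_le_right _ _) hk
    exact ⟨c, hc, hle.trans ⟨min_le_left _ _, min_le_left _ _, le_rfl⟩⟩

/-- `p` holds for all numbers up to `n`. -/
def allUpTo (n : ℕ) (p : ℕ → Bool) : Bool := (List.range (n + 1)).all p

lemma of_allUpTo {n : ℕ} {p : ℕ → Bool} (h : allUpTo n p = true) {x : ℕ} (hx : x ≤ n) :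
    p x = true :=
  List.all_eq_true.1 h x (List.mem_range.2 (Nat.lt_succ_of_le hx))

/-- The tangent space has dimension at most `80`, or at most `98` if `x ^ 2` is a standard
monomial. -/
noncomputable def boundCheck (L : List (List ℕ)) : Bool :=
  Nat.ble (irreducibles (heights L) (cells (heights L)) (corners (heights L)) []
    (corners (heights L))).length (bif Nat.beq (heights L 2 0) 0 then 80 else 98)

/-- The heights of the ideal with the largest tangent space among those containing `x ^ 2`. -/
def rows81 : List (List ℕ) := [[5, 3, 2, 1, 0], [3, 2, 1, 0], [0, 0, 0]]

/-- The heights of the ideal with the largest tangent space among those containing `x ^ 3`. -/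
def rows99 : List (List ℕ) := [[4, 3, 2, 1, 0], [3, 2, 1, 0], [1, 0, 0]]

/-- The heights of the two ideals with the largest tangent spaces. -/
def extremal : List (List (List ℕ)) := [rows81, rows99]

/-- All admissible heights with sum `17` satisfy the bound or are extremal. -/
noncomputable def enumCheck : Bool :=
  allUpTo 17 fun a0 => allUpTo (min (a0 - 1) (17 - a0)) fun a1 =>
  allUpTo (min (a1 - 1) (17 - a0 - a1)) fun a2 =>
  allUpTo (min (a2 - 1) (17 - a0 - a1 - a2)) fun a3 =>
  allUpTo (min (a3 - 1) (17 - a0 - a1 - a2 - a3)) fun a4 =>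
  allUpTo (min a1 (17 - a0 - a1 - a2 - a3 - a4)) fun b0 =>
  allUpTo (min (min a2 (b0 - 1)) (17 - a0 - a1 - a2 - a3 - a4 - b0)) fun b1 =>
  allUpTo (min (min a3 (b1 - 1)) (17 - a0 - a1 - a2 - a3 - a4 - b0 - b1)) fun b2 =>
  allUpTo (min (min a4 (b2 - 1)) (17 - a0 - a1 - a2 - a3 - a4 - b0 - b1 - b2)) fun b3 =>
  allUpTo (min b1 (17 - a0 - a1 - a2 - a3 - a4 - b0 - b1 - b2 - b3)) fun c0 =>
  allUpTo (min (min b2 (c0 - 1)) (17 - a0 - a1 - a2 - a3 - a4 - b0 - b1 - b2 - b3 - c0)) fun c1 =>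
  allUpTo (min (min b3 (c1 - 1)) (17 - a0 - a1 - a2 - a3 - a4 - b0 - b1 - b2 - b3 - c0 - c1))
    fun c2 =>
  bif Nat.beq (a0 + a1 + a2 + a3 + a4 + b0 + b1 + b2 + b3 + c0 + c1 + c2) 17 then
    boundCheck [[a0, a1, a2, a3, a4], [b0, b1, b2, b3], [c0, c1, c2]] ||
      extremal.contains [[a0, a1, a2, a3, a4], [b0, b1, b2, b3], [c0, c1, c2]]
  else true

set_option maxRecDepth 100000 in
lemma enumCheck_eq_true : enumCheck = true := by decide +kernel

/-- The values `f i j` with `i < 3` and `i + j < 5`, by rows. -/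
def rows (f : ℕ → ℕ → ℕ) : List (List ℕ) :=
  [[f 0 0, f 0 1, f 0 2, f 0 3, f 0 4], [f 1 0, f 1 1, f 1 2, f 1 3], [f 2 0, f 2 1, f 2 2]]

lemma heights_rows (hbd : Bounded f) (hdiag : ∀ i j, 5 ≤ i + j → f i j = 0) :
    heights (rows f) = f := by
  funext i j
  rcases i with _ | _ | _ | i
  · rcases j with _ | _ | _ | _ | _ | j
    all_goals first | rfl | exact (hbd _ _ (by omega)).symm
  · rcases j with _ | _ | _ | _ | j
    all_goals first | rfl | exact (hdiag _ _ (by omega)).symm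
  · rcases j with _ | _ | _ | j
    all_goals first | rfl | exact (hdiag _ _ (by omega)).symm
  · exact (hbd _ _ (by omega)).symm

lemma check_rows (hb : BorelHeights f)
    (hsum : f 0 0 + f 0 1 + f 0 2 + f 0 3 + f 0 4 + f 1 0 + f 1 1 + f 1 2 + f 1 3 +
      f 2 0 + f 2 1 + f 2 2 = 17) :
    boundCheck (rows f) = true ∨ rows f ∈ extremal := by
  have a1 : f 0 1 ≤ f 0 0 - 1 := hb.succ_right 0 0
  have a2 : f 0 2 ≤ f 0 1 - 1 := hb.succ_right 0 1
  have a3 : f 0 3 ≤ f 0 2 - 1 := hb.succ_right 0 2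
  have a4 : f 0 4 ≤ f 0 3 - 1 := hb.succ_right 0 3
  have b1 : f 1 1 ≤ f 1 0 - 1 := hb.succ_right 1 0
  have b2 : f 1 2 ≤ f 1 1 - 1 := hb.succ_right 1 1
  have b3 : f 1 3 ≤ f 1 2 - 1 := hb.succ_right 1 2
  have c1 : f 2 1 ≤ f 2 0 - 1 := hb.succ_right 2 0
  have c2 : f 2 2 ≤ f 2 1 - 1 := hb.succ_right 2 1
  have d0 : f 1 0 ≤ f 0 1 := hb.succ_left 0 0
  have d1 : f 1 1 ≤ f 0 2 := hb.succ_left 0 1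
  have d2 : f 1 2 ≤ f 0 3 := hb.succ_left 0 2
  have d3 : f 1 3 ≤ f 0 4 := hb.succ_left 0 3
  have e0 : f 2 0 ≤ f 1 1 := hb.succ_left 1 0
  have e1 : f 2 1 ≤ f 1 2 := hb.succ_left 1 1
  have e2 : f 2 2 ≤ f 1 3 := hb.succ_left 1 2
  have h := enumCheck_eq_true
  unfold enumCheck at h
  replace h := of_allUpTo h (x := f 0 0) (by omega)
  replace h := of_allUpTo h (x := f 0 1) (by omega)
  replace h := of_allUpTo h (x := f 0 2) (by omega)
  replace h := of_allUpTo h (x := f 0 3) (by omega)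
  replace h := of_allUpTo h (x := f 0 4) (by omega)
  replace h := of_allUpTo h (x := f 1 0) (by omega)
  replace h := of_allUpTo h (x := f 1 1) (by omega)
  replace h := of_allUpTo h (x := f 1 2) (by omega)
  replace h := of_allUpTo h (x := f 1 3) (by omega)
  replace h := of_allUpTo h (x := f 2 0) (by omega)
  replace h := of_allUpTo h (x := f 2 1) (by omega)
  replace h := of_allUpTo h (x := f 2 2) (by omega)
  rw [hsum] at h
  rwa [Nat.beq_refl, cond_true, Bool.or_eq_true, List.contains_iff_mem] at h

/-- The main estimate: away from two extremal ideals, tangent spaces are smaller. -/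
theorem tangentDim_le_or_extremal (hI : IsMonomialIdeal I) (hB : IsBorelFixed I)
    (hl : Module.finrank ℂ (MvPolynomial (Fin 3) ℂ ⧸ I) = 17)
    (hx : (X 0 : MvPolynomial (Fin 3) ℂ) ^ 3 ∈ I) :
    ∃ f, HasHeights I f ∧ Bounded f ∧ (tangentDim I ≤ (if f 2 0 = 0 then 80 else 98) ∨
      ∃ L ∈ extremal, f = heights L) := by
  obtain ⟨f, hf⟩ := exists_heights hI (by omega)
  have hb := BorelHeights.of_isBorelFixed hB hf
  rw [X_zero_pow, hf.mem_iff] at hx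
  have hle := (sum_heights_le hI hf (by omega) ((Finset.range 6).image fun j => (0, j))).1
  rw [Finset.sum_image (by simp), hl] at hle
  obtain ⟨hbd, hdiag⟩ := bounded_of_borelHeights hb (Nat.le_zero.1 hx) hle
  have hsum := (sum_heights_le hI hf (by omega) (Finset.range 3 ×ˢ Finset.range 5)).2
    fun i j h => by
      have := mt (hbd i j) h
      simp only [Finset.mem_product, Finset.mem_range]
      omega
  simp only [hl, Finset.sum_product, Finset.sum_range_succ, Finset.sum_range_zero] at hsum
  have h14 := hdiag 1 4 le_rfl
  have h23 := hdiag 2 3 le_rfl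
  have h24 := hdiag 2 4 (by norm_num)
  have hrows := heights_rows hbd hdiag
  refine ⟨f, hf, hbd, (check_rows hb (by omega)).imp (fun h => ?_) fun h => ⟨_, h, hrows.symm⟩⟩
  rw [boundCheck, hrows, Nat.ble_eq] at h
  refine (tangentDim_le hI hf (fun t => (mem_cells hbd t).1) (generates_corners hf hbd)).trans
    (h.trans (le_of_eq ?_))
  cases f 2 0 <;> rfl

/-- Minimal generators for `rows81`, ordered so that `irreducibles` is as short as possible. -/
def gens81 : List (ℕ × ℕ × ℕ) :=
  [(1, 2, 1), (2, 0, 0), (1, 1, 2), (0, 3, 1), (0, 2, 2), (1, 3, 0), (0, 4, 0), (1, 0, 3),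
    (0, 0, 5), (0, 1, 3)]

/-- Minimal generators for `rows99`, ordered so that `irreducibles` is as short as possible. -/
def gens99 : List (ℕ × ℕ × ℕ) :=
  [(1, 2, 1), (0, 2, 2), (2, 0, 1), (0, 1, 3), (0, 0, 4), (1, 1, 2), (0, 3, 1), (0, 4, 0),
    (1, 0, 3), (1, 3, 0), (2, 1, 0), (3, 0, 0)]

lemma bounded_heights (r s t : List ℕ) (hr : r.length ≤ 5) (hs : s.length ≤ 5)
    (ht : t.length ≤ 5) : Bounded (heights [r, s, t]) := by
  have key : ∀ (l : List ℕ) (j : ℕ), l.length ≤ j → nth 0 l j = 0 := by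
    intro l
    induction l with
    | nil => exact fun _ _ => rfl
    | cons x l ih =>
      rintro (_ | j) hj
      · simp at hj
      · exact ih j (by simpa using hj)
  rintro (_ | _ | _ | i) j h
  · exact key r j (by omega)
  · exact key s j (by omega)
  · exact key t j (by omega)
  · rfl

/-- A numerical criterion for a list to generate the ideal with the given heights. -/
def generatesCheck (f : ℕ → ℕ → ℕ) (G : List (ℕ × ℕ × ℕ)) : Bool :=
  G.all (fun g => !below f g) && (corners f).all fun c => G.any fun g => leB g c

lemma Generates.of_check (hf : HasHeights I f) (hbd : Bounded f) (h : generatesCheck f G = true) :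
    Generates G I := by
  rw [generatesCheck, Bool.and_eq_true, List.all_eq_true, List.all_eq_true] at h
  refine ⟨fun g hg => ?_, fun t ht => ?_⟩
  · by_contra hg'
    have := h.1 g hg
    rw [(hf g).1 hg'] at this
    exact Bool.noConfusion this
  · obtain ⟨c, hc, hct⟩ := (generates_corners hf hbd).2 t ht
    obtain ⟨g, hg, hgc⟩ := List.any_eq_true.1 (h.2 c hc)
    refine ⟨g, hg, le_trans ?_ hct⟩
    simpa [leB, Prod.le_def, and_assoc] using hgc

/-- A numerical criterion for `irreducibles` to index a basis of the dual of the tangent space. -/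
structure Certificate (f : ℕ → ℕ → ℕ) (G : List (ℕ × ℕ × ℕ)) (n : ℕ) : Prop where
  generates : generatesCheck f G = true
  consistent : Consistent f (cells f) G
  label_eq : ∀ s ∈ irreducibles f (cells f) G [] G, s.1 ∈ G ∧ below f s.2 ∧
    label f G G.reverse s.1 s.2 = some s
  nodup : (irreducibles f (cells f) G [] G).Nodup
  length_eq : (irreducibles f (cells f) G [] G).length = n

lemma Certificate.tangentDim_eq {n : ℕ} (h : Certificate f G n) (hI : IsMonomialIdeal I)
    (hf : HasHeights I f) (hbd : Bounded f) : tangentDim I = n :=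
  (_root_.tangentDim_eq hI hf (mem_cells hbd) (.of_check hf hbd h.generates) h.consistent
    h.label_eq h.nodup).trans h.length_eq

set_option maxRecDepth 100000 in
lemma certificate81 : Certificate (heights rows81) gens81 81 where
  generates := by decide +kernel
  consistent := by unfold Consistent; decide +kernel
  label_eq := by decide +kernel
  nodup := by decide +kernel
  length_eq := by decide +kernel

set_option maxRecDepth 100000 in
lemma certificate99 : Certificate (heights rows99) gens99 99 where
  generates := by decide +kernel
  consistent := by unfold Consistent; decide +kernel
  label_eq := by decide +kernel
  nodup := by decide +kernel
  length_eq := by decide +kernel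

lemma bounded_rows81 : Bounded (heights rows81) :=
  bounded_heights _ _ _ (by decide) (by decide) (by decide)

lemma bounded_rows99 : Bounded (heights rows99) :=
  bounded_heights _ _ _ (by decide) (by decide) (by decide)

/-- The monomial ideal with the given heights. -/
noncomputable def idealOf (f : ℕ → ℕ → ℕ) : Ideal (MvPolynomial (Fin 3) ℂ) :=
  Ideal.span ((fun d => monomial d (1 : ℂ)) '' {d | f (d 0) (d 1) ≤ d 2})

lemma mem_idealOf (hb : BorelHeights f) {p : MvPolynomial (Fin 3) ℂ} :
    p ∈ idealOf f ↔ ∀ d ∈ p.support, f (d 0) (d 1) ≤ d 2 := by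
  have hr : ∀ i, Antitone (f i) := fun i =>
    antitone_nat_of_succ_le fun j => (hb.succ_right i j).trans (Nat.sub_le _ _)
  have hl : ∀ j, Antitone fun i => f i j := fun j =>
    antitone_nat_of_succ_le fun i => (hb.succ_left i j).trans (hr i j.le_succ)
  rw [idealOf, mem_ideal_span_monomial_image]
  refine forall₂_congr fun d _ => ⟨fun ⟨e, he, hed⟩ => ?_, fun h => ⟨d, h, le_rfl⟩⟩
  exact ((hl _ (hed 0)).trans (hr _ (hed 1))).trans (le_trans he (hed 2))

lemma monomial_mem_idealOf (hb : BorelHeights f) (d : Fin 3 →₀ ℕ) :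
    monomial d (1 : ℂ) ∈ idealOf f ↔ f (d 0) (d 1) ≤ d 2 := by
  rw [mem_idealOf hb, support_monomial, if_neg one_ne_zero]
  simp

lemma isMonomialIdeal_idealOf (hb : BorelHeights f) : IsMonomialIdeal (idealOf f) :=
  fun _ hp d hd => (monomial_mem_idealOf hb d).2 ((mem_idealOf hb).1 hp d hd)

lemma hasHeights_idealOf (hb : BorelHeights f) : HasHeights (idealOf f) f := fun t => by
  rw [mon, monomial_mem_idealOf hb]
  simp [below]

lemma isBorelFixed_idealOf (hb : BorelHeights f) : IsBorelFixed (idealOf f) := by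
  intro d hd i j hij hj
  rw [monomial_mem_idealOf hb] at hd ⊢
  have h1 := hb.succ_right
  have h2 := hb.succ_left
  obtain ⟨rfl, rfl⟩ | ⟨rfl, rfl⟩ | ⟨rfl, rfl⟩ : (i = 0 ∧ j = 1) ∨ (i = 1 ∧ j = 2) ∨
      (i = 0 ∧ j = 2) := by
    clear hd hj; revert i j; decide
  · have := h2 (d 0) (d 1 - 1)
    rw [Nat.sub_add_cancel hj] at this
    simpa using this.trans hd
  · have := h1 (d 0) (d 1)
    simp
    omega
  · have := h1 (d 0) (d 1)
    have := h2 (d 0) (d 1)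
    simp
    omega

lemma finrank_idealOf (hb : BorelHeights f) (hbd : Bounded f) :
    Module.finrank ℂ (MvPolynomial (Fin 3) ℂ ⧸ idealOf f) = (cells f).toFinset.card := by
  rw [finrank_quotient (isMonomialIdeal_idealOf hb), ← Set.ncard_coe_finset]
  congr 1
  ext t
  rw [List.coe_toFinset, Set.mem_ofPred_eq, Set.mem_ofPred_eq, hasHeights_idealOf hb,
    mem_cells hbd]

lemma borelHeights_of_bounded (hbd : Bounded f)
    (h : ∀ i ∈ List.range 3, ∀ j ∈ List.range 5, f i (j + 1) ≤ f i j - 1 ∧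
      f (i + 1) j ≤ f i (j + 1)) : BorelHeights f := by
  simp only [List.mem_range] at h
  refine ⟨fun i j => ?_, fun i j => ?_⟩
  · by_cases hij : i < 3 ∧ j < 5
    · exact (h i hij.1 j hij.2).1
    · rw [hbd i (j + 1) (by omega)]; exact Nat.zero_le _
  · by_cases hij : i < 3 ∧ j < 5
    · exact (h i hij.1 j hij.2).2
    · rw [hbd (i + 1) j (by omega)]; exact Nat.zero_le _

lemma borelHeights_rows81 : BorelHeights (heights rows81) :=
  borelHeights_of_bounded bounded_rows81 (by decide +kernel)

lemma borelHeights_rows99 : BorelHeights (heights rows99) :=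
  borelHeights_of_bounded bounded_rows99 (by decide +kernel)

lemma X_pow_mem_iff (hf : HasHeights I f) (n : ℕ) :
    (X 0 : MvPolynomial (Fin 3) ℂ) ^ n ∈ I ↔ f n 0 = 0 := by
  rw [X_zero_pow, hf.mem_iff, Nat.le_zero]

lemma tmaxEq_two : TmaxEq 17 2 81 := by
  have hb := borelHeights_rows81
  have hI := isMonomialIdeal_idealOf hb
  have hf := hasHeights_idealOf hb
  refine ⟨⟨idealOf (heights rows81), hI, isBorelFixed_idealOf hb, ?_, ?_, ?_,
    (certificate81.tangentDim_eq hI hf bounded_rows81).symm⟩, ?_⟩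
  · rw [finrank_idealOf hb bounded_rows81]
    decide +kernel
  · exact (X_pow_mem_iff hf _).2 rfl
  · rw [X_pow_mem_iff hf]
    decide +kernel
  · rintro _ ⟨I, hI, hB, hl, hx, -, rfl⟩
    obtain ⟨f, hf, hbd, h | ⟨L, hL, rfl⟩⟩ :=
      tangentDim_le_or_extremal hI hB hl (Ideal.pow_mem_of_pow_mem I hx (by norm_num))
    · rw [X_pow_mem_iff hf] at hx
      rw [if_pos hx] at h
      omega
    · rw [X_pow_mem_iff hf] at hx
      simp only [extremal, List.mem_cons, List.not_mem_nil, or_false] at hL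
      obtain rfl | rfl := hL
      · exact (certificate81.tangentDim_eq hI hf hbd).le
      · exact absurd hx (by decide +kernel)

lemma tmaxEq_three : TmaxEq 17 3 99 := by
  have hb := borelHeights_rows99
  have hI := isMonomialIdeal_idealOf hb
  have hf := hasHeights_idealOf hb
  refine ⟨⟨idealOf (heights rows99), hI, isBorelFixed_idealOf hb, ?_, ?_, ?_,
    (certificate99.tangentDim_eq hI hf bounded_rows99).symm⟩, ?_⟩
  · rw [finrank_idealOf hb bounded_rows99]
    decide +kernel
  · exact (X_pow_mem_iff hf _).2 rfl
  · rw [X_pow_mem_iff hf]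
    decide +kernel
  · rintro _ ⟨I, hI, hB, hl, hx, -, rfl⟩
    obtain ⟨f, hf, hbd, h | ⟨L, hL, rfl⟩⟩ := tangentDim_le_or_extremal hI hB hl hx
    · split_ifs at h <;> omega
    · simp only [extremal, List.mem_cons, List.not_mem_nil, or_false] at hL
      obtain rfl | rfl := hL
      · exact (certificate81.tangentDim_eq hI hf hbd).le.trans (by norm_num)
      · exact (certificate99.tangentDim_eq hI hf hbd).le

lemma lt_of_tmaxEq_one {T : ℕ} (h : TmaxEq 17 1 T) : T < 81 := by
  obtain ⟨I, hI, hB, hl, hx, -, rfl⟩ := h.1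
  have hx2 := Ideal.pow_mem_of_pow_mem I hx (show 1 ≤ 2 by norm_num)
  obtain ⟨f, hf, hbd, h | ⟨L, hL, rfl⟩⟩ :=
    tangentDim_le_or_extremal hI hB hl (Ideal.pow_mem_of_pow_mem I hx (by norm_num))
  · rw [if_pos ((X_pow_mem_iff hf 2).1 hx2)] at h
    omega
  · rw [X_pow_mem_iff hf] at hx
    simp only [extremal, List.mem_cons, List.not_mem_nil, or_false] at hL
    obtain rfl | rfl := hL <;> exact absurd hx (by decide +kernel)

end MonomialIdeal

theorem Tmax_monotonicity_l17 :
    TmaxEq 17 2 81 ∧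
    TmaxEq 17 3 99 ∧
    (∀ T1 T2 T3 : ℕ, TmaxEq 17 1 T1 → TmaxEq 17 2 T2 → TmaxEq 17 3 T3 →
      T1 < T2 ∧ T2 < T3) := by
  refine ⟨tmaxEq_two, tmaxEq_three, fun T1 T2 T3 h1 h2 h3 => ?_⟩
  obtain rfl := h2.unique tmaxEq_two
  obtain rfl := h3.unique tmaxEq_three
  exact ⟨lt_of_tmaxEq_one h1, by norm_num⟩
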